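/- Under the convexity and qualification assumptions, the dual problem (D) has a nonempty and bounded set of optimal solutions, and val(D) = val(P̃). -/

import Mathlib

noncomputable section
open Finset Filter Topology Bornology
open scoped Classical Pointwise

/-- Fenchel conjugate of a function on a finite coordinate space. -/
def conjFn {d : Type*} [Fintype d] (g : (d → ℝ) → EReal) (y : d → ℝ) : EReal :=
  ⨆ x : d → ℝ, (↑(∑ i, x i * y i) : EReal) - g x

/-- Fenchel conjugate, scalar case. -/
def conjR (g : ℝ → EReal) (y : ℝ) : EReal :=
  ⨆ x : ℝ, (↑(x * y) : EReal) - g x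

/-- Subdifferential (empty where `g = ⊤`). -/
def subdiffFn {d : Type*} [Fintype d] (g : (d → ℝ) → EReal) (x : d → ℝ) : Set (d → ℝ) :=
  {p | g x ≠ ⊤ ∧ ∀ x', g x + (↑(∑ i, p i * (x' i - x i)) : EReal) ≤ g x'}

def subdiffR (g : ℝ → EReal) (x : ℝ) : Set ℝ :=
  {p | g x ≠ ⊤ ∧ ∀ x', g x + (↑(p * (x' - x)) : EReal) ≤ g x'}

def EProper {E : Type*} (g : E → EReal) : Prop := (∃ x, g x ≠ ⊤) ∧ ∀ x, g x ≠ ⊥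

def EConvexOn {E : Type*} [AddCommMonoid E] [SMul ℝ E] (g : E → EReal) : Prop :=
  ∀ x y : E, ∀ a b : ℝ, 0 ≤ a → 0 ≤ b → a + b = 1 →
    g (a • x + b • y) ≤ (a : EReal) * g x + (b : EReal) * g y

def EStrictConvexOn {E : Type*} [AddCommMonoid E] [SMul ℝ E] (g : E → EReal) : Prop :=
  ∀ x y : E, x ≠ y → g x ≠ ⊤ → g y ≠ ⊤ → ∀ a b : ℝ, 0 < a → 0 < b → a + b = 1 →
    g (a • x + b • y) < (a : EReal) * g x + (b : EReal) * g y

/-- Perspective function. -/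
def persp {d : Type*} [Fintype d] (h : (d → ℝ) → EReal) (θ : ℝ) (x : d → ℝ) : EReal :=
  if 0 < θ then (θ : EReal) * h (θ⁻¹ • x)
  else if θ = 0 ∧ x = 0 then 0 else ⊤

/-- The simplex `Δ(S)`. -/
def simplex (n : ℕ) : Set (Fin n → ℝ) :=
  {ρ | (∀ y, ρ y ∈ Set.Icc (0 : ℝ) 1) ∧ ∑ y, ρ y = 1}

abbrev Msp (T n : ℕ) := Fin (T + 1) → Fin n → ℝ
abbrev Wsp (T n : ℕ) := Fin T → Fin n → Fin n → ℝ
abbrev Psp (T : ℕ) := Fin T → ℝ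
abbrev Csp (T n : ℕ) := Msp T n × Wsp T n × Msp T n × Psp T
abbrev Ksp (T n : ℕ) := Msp T n × Msp T n × Psp T
abbrev LSp (T n : ℕ) := Fin T → Fin n → (Fin n → ℝ) → EReal
abbrev FSp (T n : ℕ) := Fin (T + 1) → (Fin n → ℝ) → EReal
abbrev PhiSp (T : ℕ) := Fin T → ℝ → EReal
abbrev ASp (T n : ℕ) := Fin T → Fin n → Fin n → ℝ

variable {T n : ℕ}

def opA (α : ASp T n) (w : Wsp T n) (t : Fin T) : ℝ := ∑ x, ∑ y, w t x y * α t x y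

def opS (w : Wsp T n) (s : Fin (T + 1)) (x : Fin n) : ℝ :=
  if h : (s : ℕ) = 0 then 0
  else ∑ y, w ⟨(s : ℕ) - 1, by have := s.isLt; omega⟩ y x

def mbar0 (m0 : Fin n → ℝ) (s : Fin (T + 1)) (x : Fin n) : ℝ := if s = 0 then m0 x else 0

def Qcpl (α : ASp T n) (m : Msp T n) (π : Wsp T n) (t : Fin T) : ℝ :=
  ∑ x, ∑ y, m t.castSucc x * π t x y * α t x y

def IsKol (m0 : Fin n → ℝ) (π : Wsp T n) (m : Msp T n) : Prop :=
  (∀ x, m 0 x = m0 x) ∧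
    ∀ (t : Fin T) (x : Fin n), m t.succ x = ∑ y, m t.castSucc y * π t y x

def InDelta (π : Wsp T n) : Prop := ∀ t x, π t x ∈ simplex n

def ConvAssumption (ℓ : LSp T n) (F : FSp T n) (φ : PhiSp T) : Prop :=
  (∀ t x, EProper (ℓ t x) ∧ EConvexOn (ℓ t x) ∧ LowerSemicontinuous (ℓ t x) ∧
    ∀ ρ, ℓ t x ρ ≠ ⊤ → ρ ∈ simplex n) ∧
  (∀ s, EProper (F s) ∧ EConvexOn (F s) ∧ LowerSemicontinuous (F s)) ∧
  (∀ t, EProper (φ t) ∧ EConvexOn (φ t) ∧ LowerSemicontinuous (φ t))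

def Jpot (ℓ : LSp T n) (F : FSp T n) (φ : PhiSp T) (α : ASp T n)
    (m : Msp T n) (π : Wsp T n) : EReal :=
  (∑ t, ∑ x, (↑(m t.castSucc x) : EReal) * ℓ t x (π t x)) +
    (∑ t, φ t (Qcpl α m π t)) + ∑ s, F s (m s)

def Jtil (ℓ : LSp T n) (F : FSp T n) (φ : PhiSp T) (α : ASp T n)
    (m : Msp T n) (w : Wsp T n) : EReal :=
  (∑ t, ∑ x, persp (ℓ t x) (m t.castSucc x) (w t x)) +
    (∑ t, φ t (opA α w t)) + ∑ s, F s (m s)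

def FeasP (m0 : Fin n → ℝ) (p : Msp T n × Wsp T n) : Prop := InDelta p.2 ∧ IsKol m0 p.2 p.1

def FeasPt (m0 : Fin n → ℝ) (p : Msp T n × Wsp T n) : Prop :=
  ∀ s x, opS p.2 s x - p.1 s x + mbar0 m0 s x = 0

def valP (ℓ : LSp T n) (F : FSp T n) (φ : PhiSp T) (α : ASp T n) (m0 : Fin n → ℝ) : EReal :=
  ⨅ p ∈ {p : Msp T n × Wsp T n | FeasP m0 p}, Jpot ℓ F φ α p.1 p.2

def valPt (ℓ : LSp T n) (F : FSp T n) (φ : PhiSp T) (α : ASp T n) (m0 : Fin n → ℝ) : EReal :=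
  ⨅ p ∈ {p : Msp T n × Wsp T n | FeasPt m0 p}, Jtil ℓ F φ α p.1 p.2

def IsSolP (ℓ : LSp T n) (F : FSp T n) (φ : PhiSp T) (α : ASp T n) (m0 : Fin n → ℝ)
    (p : Msp T n × Wsp T n) : Prop :=
  FeasP m0 p ∧ ∀ q, FeasP m0 q → Jpot ℓ F φ α p.1 p.2 ≤ Jpot ℓ F φ α q.1 q.2

def IsSolPt (ℓ : LSp T n) (F : FSp T n) (φ : PhiSp T) (α : ASp T n) (m0 : Fin n → ℝ)
    (p : Msp T n × Wsp T n) : Prop :=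
  FeasPt m0 p ∧ ∀ q, FeasPt m0 q → Jtil ℓ F φ α p.1 p.2 ≤ Jtil ℓ F φ α q.1 q.2

def dpCost (ℓ : LSp T n) (α : ASp T n) (u : Msp T n) (P : Psp T)
    (t : Fin T) (x : Fin n) : EReal :=
  conjFn (ℓ t x) (fun y => -(α t x y * P t + u t.succ y))

def FeasD (ℓ : LSp T n) (α : ASp T n) (k : Ksp T n) : Prop :=
  (∀ t x, (↑(k.1 t.castSucc x) : EReal) + dpCost ℓ α k.1 k.2.2 t x ≤ ↑(k.2.1 t.castSucc x)) ∧
  ∀ x, k.1 (Fin.last T) x = k.2.1 (Fin.last T) x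

def Dobj (F : FSp T n) (φ : PhiSp T) (m0 : Fin n → ℝ) (k : Ksp T n) : EReal :=
  (↑(∑ x, m0 x * k.1 0 x) : EReal) - (∑ t, conjR (φ t) (k.2.2 t)) -
    ∑ s, conjFn (F s) (k.2.1 s)

def valD (ℓ : LSp T n) (F : FSp T n) (φ : PhiSp T) (α : ASp T n) (m0 : Fin n → ℝ) : EReal :=
  ⨆ k ∈ {k : Ksp T n | FeasD ℓ α k}, Dobj F φ m0 k

def IsSolD (ℓ : LSp T n) (F : FSp T n) (φ : PhiSp T) (α : ASp T n) (m0 : Fin n → ℝ)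
    (k : Ksp T n) : Prop :=
  FeasD ℓ α k ∧ ∀ k', FeasD ℓ α k' → Dobj F φ m0 k' ≤ Dobj F φ m0 k

/-- `IsDP ℓ α γ P u` : `u = U[γ,P]`, i.e. `u` solves the dynamic programming equation. -/
def IsDP (ℓ : LSp T n) (α : ASp T n) (γ : Msp T n) (P : Psp T) (u : Msp T n) : Prop :=
  (∀ (t : Fin T) (x : Fin n),
    (↑(u t.castSucc x) : EReal) + dpCost ℓ α u P t x = ↑(γ t.castSucc x)) ∧
  ∀ x, u (Fin.last T) x = γ (Fin.last T) x

def valDt (ℓ : LSp T n) (F : FSp T n) (φ : PhiSp T) (α : ASp T n) (m0 : Fin n → ℝ) : EReal :=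
  ⨆ k ∈ {k : Ksp T n | IsDP ℓ α k.2.1 k.2.2 k.1}, Dobj F φ m0 k

def IsSolDt (ℓ : LSp T n) (F : FSp T n) (φ : PhiSp T) (α : ASp T n) (m0 : Fin n → ℝ)
    (γ : Msp T n) (P : Psp T) (u : Msp T n) : Prop :=
  IsDP ℓ α γ P u ∧
    ∀ γ' P' u', IsDP ℓ α γ' P' u' → Dobj F φ m0 (u', γ', P') ≤ Dobj F φ m0 (u, γ, P)

def IsKolPert (m0 : Fin n → ℝ) (ε1 : Msp T n) (π : Wsp T n) (m1 : Msp T n) : Prop :=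
  (∀ x, m1 0 x = mbar0 m0 (0 : Fin (T + 1)) x + ε1 0 x) ∧
  ∀ (t : Fin T) (x : Fin n), m1 t.succ x = (∑ y, m1 t.castSucc y * π t y x) - ε1 t.succ x

def qnorm (ε1 ε2 : Msp T n) (ε3 : Psp T) : ℝ :=
  Real.sqrt ((∑ s, ∑ x, ε1 s x ^ 2) + (∑ s, ∑ x, ε2 s x ^ 2) + ∑ t, ε3 t ^ 2)

def Qualif (ℓ : LSp T n) (F : FSp T n) (φ : PhiSp T) (α : ASp T n) (m0 : Fin n → ℝ) : Prop :=
  ∃ α0 : ℝ, 0 < α0 ∧ ∀ (ε1 ε2 : Msp T n) (ε3 : Psp T), qnorm ε1 ε2 ε3 ≤ α0 →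
    ∃ π : Wsp T n, (∀ t x, ℓ t x (π t x) ≠ ⊤) ∧
      ∃ m1 : Msp T n, IsKolPert m0 ε1 π m1 ∧ (∀ s x, 0 ≤ m1 s x) ∧
        (∀ s, F s (fun x => m1 s x + ε2 s x) ≠ ⊤) ∧
        ∀ t, φ t (Qcpl α m1 π t + ε3 t) ≠ ⊤

def Fobj (ℓ : LSp T n) (F : FSp T n) (φ : PhiSp T) (c : Csp T n) : EReal :=
  (∑ t, ∑ x, persp (ℓ t x) (c.1 t.castSucc x) (c.2.1 t x)) +
    (∑ t, φ t (c.2.2.2 t)) + ∑ s, F s (c.2.2.1 s)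

def Gobj (m0 : Fin n → ℝ) (k : Ksp T n) : EReal :=
  if (∀ s x, k.1 s x = -(mbar0 m0 s x)) ∧ k.2.1 = 0 ∧ k.2.2 = 0 then 0 else ⊤

def Aop (α : ASp T n) (c : Csp T n) : Ksp T n :=
  (fun s x => opS c.2.1 s x - c.1 s x,
   fun s x => c.1 s x - c.2.2.1 s x,
   fun t => opA α c.2.1 t - c.2.2.2 t)

def AstarOp (α : ASp T n) (k : Ksp T n) : Csp T n :=
  (fun s x => k.2.1 s x - k.1 s x,
   fun t x y => α t x y * k.2.2 t + k.1 t.succ y,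
   fun s x => -k.2.1 s x,
   fun t => -k.2.2 t)

def cpair (c c' : Csp T n) : ℝ :=
  (∑ s, ∑ x, c.1 s x * c'.1 s x) + (∑ t, ∑ x, ∑ y, c.2.1 t x y * c'.2.1 t x y) +
    (∑ s, ∑ x, c.2.2.1 s x * c'.2.2.1 s x) + ∑ t, c.2.2.2 t * c'.2.2.2 t

def kpair (k k' : Ksp T n) : ℝ :=
  (∑ s, ∑ x, k.1 s x * k'.1 s x) + (∑ s, ∑ x, k.2.1 s x * k'.2.1 s x) +
    ∑ t, k.2.2 t * k'.2.2 t

def FobjStar (ℓ : LSp T n) (F : FSp T n) (φ : PhiSp T) (c' : Csp T n) : EReal :=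
  ⨆ c : Csp T n, (↑(cpair c c') : EReal) - Fobj ℓ F φ c

def GobjStar (m0 : Fin n → ℝ) (k : Ksp T n) : EReal := ↑(-(∑ x, m0 x * k.1 0 x))

def PfrakObj (ℓ : LSp T n) (F : FSp T n) (φ : PhiSp T) (α : ASp T n) (m0 : Fin n → ℝ)
    (c : Csp T n) : EReal := Fobj ℓ F φ c + Gobj m0 (Aop α c)

def DfrakObj (ℓ : LSp T n) (F : FSp T n) (φ : PhiSp T) (α : ASp T n) (m0 : Fin n → ℝ)
    (k : Ksp T n) : EReal := FobjStar ℓ F φ (-AstarOp α k) + GobjStar m0 k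

def IsSolPfrak (ℓ : LSp T n) (F : FSp T n) (φ : PhiSp T) (α : ASp T n) (m0 : Fin n → ℝ)
    (c : Csp T n) : Prop := ∀ c', PfrakObj ℓ F φ α m0 c ≤ PfrakObj ℓ F φ α m0 c'

def IsSolDfrak (ℓ : LSp T n) (F : FSp T n) (φ : PhiSp T) (α : ASp T n) (m0 : Fin n → ℝ)
    (k : Ksp T n) : Prop := ∀ k', DfrakObj ℓ F φ α m0 k ≤ DfrakObj ℓ F φ α m0 k'

def MFGi (ℓ : LSp T n) (α : ASp T n) (γ : Msp T n) (P : Psp T) (u : Msp T n) : Prop :=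
  (∀ (t : Fin T) (x : Fin n), (↑(u t.castSucc x) : EReal) =
      ⨅ ρ ∈ simplex n,
        ℓ t x ρ + ↑(γ t.castSucc x) + ↑(∑ y, ρ y * (α t x y * P t + u t.succ y))) ∧
  ∀ x, u (Fin.last T) x = γ (Fin.last T) x

def MFGii (ℓ : LSp T n) (α : ASp T n) (π : Wsp T n) (γ : Msp T n) (P : Psp T)
    (u : Msp T n) : Prop :=
  ∀ (t : Fin T) (x : Fin n),
    ℓ t x (π t x) + ↑(γ t.castSucc x) + ↑(∑ y, π t x y * (α t x y * P t + u t.succ y)) =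
      (↑(u t.castSucc x) : EReal)

def IsMFGSol (ℓ : LSp T n) (F : FSp T n) (φ : PhiSp T) (α : ASp T n) (m0 : Fin n → ℝ)
    (m : Msp T n) (π : Wsp T n) (u : Msp T n) (γ : Msp T n) (P : Psp T) : Prop :=
  InDelta π ∧ MFGi ℓ α γ P u ∧ MFGii ℓ α π γ P u ∧ IsKol m0 π m ∧
    (∀ s, γ s ∈ subdiffFn (F s) (m s)) ∧ ∀ t, P t ∈ subdiffR (φ t) (Qcpl α m π t)


/-! ### Subgradients of convex value functions -/

/-- A convex set `E ⊆ K × ℝ` lying above `v` over the origin, and whose projection to `K` is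
absorbing, admits a supporting affine function through `(0, v)`. -/
theorem exists_linearMap_supporting {K : Type*} [AddCommGroup K] [Module ℝ K]
    {E : Set (K × ℝ)} (hE : Convex ℝ E) {v : ℝ} (hv : ∀ r, ((0 : K), r) ∈ E → v ≤ r)
    (habs : ∀ k : K, ∃ δ : ℝ, 0 < δ ∧ ∃ r, (δ • k, r) ∈ E) :
    ∃ g : K →ₗ[ℝ] ℝ, ∀ z ∈ E, v ≤ z.2 + g z.1 := by
  obtain ⟨δ₀, hδ₀, r₀, hr₀⟩ := habs 0
  let C : PointedCone ℝ (K × ℝ) :=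
    { carrier := {y | ∃ c : ℝ, 0 ≤ c ∧ ∃ z ∈ E, y.1 = c • z.1 ∧ c * (z.2 - v) ≤ y.2}
      zero_mem' := ⟨0, le_rfl, _, hr₀, by simp, by simp⟩
      add_mem' := by
        rintro ⟨y₁, s₁⟩ ⟨y₂, s₂⟩ ⟨c₁, hc₁, z₁, hz₁, h₁, h₁'⟩ ⟨c₂, hc₂, z₂, hz₂, h₂, h₂'⟩
        dsimp only at h₁ h₂ h₁' h₂'
        rcases (add_nonneg hc₁ hc₂).eq_or_lt with h | h
        · have e₁ : c₁ = 0 := by linarith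
          have e₂ : c₂ = 0 := by linarith
          subst e₁ e₂
          refine ⟨0, le_rfl, z₁, hz₁, by simp [h₁, h₂], ?_⟩
          simp only [Prod.snd_add]
          linarith
        · refine ⟨c₁ + c₂, h.le, (c₁ / (c₁ + c₂)) • z₁ + (c₂ / (c₁ + c₂)) • z₂,
            hE hz₁ hz₂ (by positivity) (by positivity) (by field_simp), ?_, ?_⟩
          · simp only [Prod.fst_add, Prod.smul_fst, h₁, h₂, smul_add, smul_smul]
            congr 2 <;> field_simp
          · simp only [Prod.snd_add, Prod.smul_snd, smul_eq_mul]
            have : (c₁ + c₂) * (c₁ / (c₁ + c₂) * z₁.2 + c₂ / (c₁ + c₂) * z₂.2 - v) =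
                c₁ * (z₁.2 - v) + c₂ * (z₂.2 - v) := by field_simp; ring
            linarith
      smul_mem' := by
        rintro ⟨a, ha⟩ ⟨y, s⟩ ⟨c, hc, z, hz, h, h'⟩
        dsimp only at h h'
        refine ⟨a * c, mul_nonneg ha hc, z, hz, ?_, ?_⟩
        · change a • y = _
          rw [h, smul_smul]
        · change _ ≤ a * s
          rw [mul_assoc]
          exact mul_le_mul_of_nonneg_left h' ha }
  have hne : ((0 : K), (1 : ℝ)) ≠ 0 := by simp
  let f : (K × ℝ) →ₗ.[ℝ] ℝ := LinearPMap.mkSpanSingleton ((0 : K), (1 : ℝ)) (1 : ℝ) hne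
  have hf : ∀ (c : ℝ) (h : c • ((0 : K), (1 : ℝ)) ∈ f.domain), f ⟨_, h⟩ = c := by
    intro c h
    have := LinearPMap.mkSpanSingleton'_apply (R := ℝ) ((0 : K), (1 : ℝ)) (1 : ℝ)
      (by simp) c h
    exact this.trans (by simp)
  have hmem : ∀ c : ℝ, c • ((0 : K), (1 : ℝ)) ∈ f.domain := fun c =>
    Submodule.mem_span_singleton.2 ⟨c, rfl⟩
  obtain ⟨g, hg, hgC⟩ := riesz_extension C f
    (by
      rintro ⟨x, hx⟩ hxC
      obtain ⟨c, rfl⟩ := Submodule.mem_span_singleton.1 hx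
      rw [hf]
      obtain ⟨a, ha, z, hz, h, h'⟩ := hxC
      simp only [Prod.smul_fst, smul_zero, Prod.smul_snd, smul_eq_mul, mul_one] at h h'
      rcases ha.eq_or_lt with rfl | ha
      · simpa using h'
      · have hz0 : z.1 = 0 := (smul_eq_zero.1 h.symm).resolve_left ha.ne'
        have : v ≤ z.2 := hv _ (by rw [← hz0]; exact hz)
        nlinarith)
    (by
      rintro ⟨k, s⟩
      obtain ⟨δ, hδ, r, hr⟩ := habs k
      refine ⟨⟨_, hmem (δ⁻¹ * (r - v) - s)⟩, δ⁻¹, by positivity, _, hr, ?_, ?_⟩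
      · simp [smul_smul, hδ.ne']
      · simp)
  refine ⟨g ∘ₗ LinearMap.inl ℝ K ℝ, fun z hz => ?_⟩
  have h0 := hgC (z.1, z.2 - v) ⟨1, zero_le_one, z, hz, by simp, by simp⟩
  have h1 := hg ⟨_, hmem (z.2 - v)⟩
  rw [hf] at h1
  have h2 : ((z.1, z.2 - v) : K × ℝ) = (z.1, 0) + (z.2 - v) • ((0 : K), (1 : ℝ)) := by simp
  rw [h2, map_add] at h0
  simp only at h1
  rw [h1] at h0
  simp only [LinearMap.comp_apply, LinearMap.inl_apply]
  linarith

/-! ### Extended-real bookkeeping -/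

theorem EReal.coe_sum_fintype {ι : Type*} (s : Finset ι) (f : ι → ℝ) :
    ((∑ i ∈ s, f i : ℝ) : EReal) = ∑ i ∈ s, (f i : EReal) :=
  map_sum (⟨⟨Real.toEReal, EReal.coe_zero⟩, EReal.coe_add⟩ : ℝ →+ EReal) f s

theorem EReal.sum_ne_bot {ι : Type*} {s : Finset ι} {f : ι → EReal}
    (h : ∀ i ∈ s, f i ≠ ⊥) : ∑ i ∈ s, f i ≠ ⊥ := by
  induction s using Finset.induction_on with
  | empty => simp
  | insert a s ha ih =>
    rw [Finset.sum_insert ha]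
    simp only [ne_eq, EReal.add_eq_bot_iff, not_or]
    exact ⟨h a (by simp), ih fun i hi => h i (by simp [hi])⟩

theorem EReal.ne_top_of_sum_ne_top {ι : Type*} {s : Finset ι} {f : ι → EReal}
    (h : ∀ i ∈ s, f i ≠ ⊥) (hs : ∑ i ∈ s, f i ≠ ⊤) : ∀ i ∈ s, f i ≠ ⊤ := by
  intro i hi hf
  apply hs
  rw [← Finset.add_sum_erase s f hi, hf]
  exact EReal.top_add_of_ne_bot (EReal.sum_ne_bot fun j hj => h j (Finset.mem_of_mem_erase hj))

theorem EReal.ne_bot_of_sum_ne_bot {ι : Type*} {s : Finset ι} {f : ι → EReal}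
    (hs : ∑ i ∈ s, f i ≠ ⊥) : ∀ i ∈ s, f i ≠ ⊥ := by
  intro i hi hf
  apply hs
  rw [← Finset.add_sum_erase s f hi, hf, EReal.bot_add]

theorem EReal.exists_coe_eq {a : EReal} (h₁ : a ≠ ⊤) (h₂ : a ≠ ⊥) : ∃ r : ℝ, a = r :=
  ⟨a.toReal, (EReal.coe_toReal h₁ h₂).symm⟩

theorem EReal.exists_coe_eq_of_sum {ι : Type*} [Fintype ι] {f : ι → EReal}
    (h : ∀ i, f i ≠ ⊥) (hs : ∑ i, f i ≠ ⊤) : ∃ r : ι → ℝ, ∀ i, f i = r i :=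
  ⟨fun i => (f i).toReal, fun i => (EReal.coe_toReal
    (EReal.ne_top_of_sum_ne_top (fun i _ => h i) hs i (Finset.mem_univ i)) (h i)).symm⟩

/-- A sum of suprema is approximated by a simultaneous choice of arguments. -/
theorem EReal.exists_lt_sum_of_lt_sum_iSup {ι X : Type*} [Nonempty X] (s : Finset ι)
    (a : ι → X → EReal) (b : EReal) (hb : b < ∑ i ∈ s, ⨆ x, a i x) :
    ∃ x : ι → X, b < ∑ i ∈ s, a i (x i) := by
  induction s using Finset.induction_on generalizing b with
  | empty => exact ⟨fun _ => Classical.arbitrary X, by simpa using hb⟩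
  | insert i s hi ih =>
    by_contra! hcon
    rw [Finset.sum_insert hi] at hb
    refine absurd hb (not_lt.2 (EReal.add_le_of_forall_lt fun p hp q hq => ?_))
    obtain ⟨x₀, hx₀⟩ := lt_iSup_iff.1 hp
    obtain ⟨x, hx⟩ := ih q hq
    refine le_trans ?_ (hcon (Function.update x i x₀))
    rw [Finset.sum_insert hi, Function.update_self]
    refine add_le_add hx₀.le (hx.le.trans_eq (Finset.sum_congr rfl fun j hj => ?_))
    rw [Function.update_of_ne (ne_of_mem_of_not_mem hj hi)]

/-! ### Real-valued consequences of properness, convexity and lower semicontinuity -/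

theorem EConvexOn.le_coe {E : Type*} [AddCommMonoid E] [SMul ℝ E] {g : E → EReal}
    (hg : EConvexOn g) {x y : E} {a b c d : ℝ} (ha : 0 ≤ a) (hb : 0 ≤ b) (hab : a + b = 1)
    (hx : g x ≤ c) (hy : g y ≤ d) : g (a • x + b • y) ≤ ((a * c + b * d : ℝ) : EReal) := by
  refine (hg x y a b ha hb hab).trans ?_
  push_cast
  exact add_le_add (mul_le_mul_of_nonneg_left hx (by exact_mod_cast ha))
    (mul_le_mul_of_nonneg_left hy (by exact_mod_cast hb))

theorem EProper.exists_le_coe {E : Type*} {g : E → EReal} (hg : EProper g) :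
    ∃ x, ∃ r : ℝ, g x ≤ r := by
  obtain ⟨⟨x, hx⟩, hb⟩ := hg
  exact ⟨x, (g x).toReal, (EReal.coe_toReal hx (hb x)).ge⟩

/-- A lower semicontinuous function that never takes the value `⊥` is bounded below on compacta. -/
theorem LowerSemicontinuous.exists_coe_le {E : Type*} [TopologicalSpace E] {g : E → EReal}
    (hg : LowerSemicontinuous g) (hb : ∀ x, g x ≠ ⊥) {s : Set E} (hs : IsCompact s) :
    ∃ L : ℝ, ∀ x ∈ s, (L : EReal) ≤ g x := by
  rcases s.eq_empty_or_nonempty with rfl | hne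
  · exact ⟨0, by simp⟩
  obtain ⟨a, -, ha⟩ := (hg.lowerSemicontinuousOn s).exists_isMinOn hne hs
  obtain ⟨L, -, hL⟩ := EReal.lt_iff_exists_real_btwn.1 (bot_lt_iff_ne_bot.2 (hb a))
  exact ⟨L, fun x hx => hL.le.trans (ha hx)⟩

theorem EProper.conjFn_ne_bot {d : Type*} [Fintype d] {g : (d → ℝ) → EReal} (hg : EProper g)
    (y : d → ℝ) : conjFn g y ≠ ⊥ := by
  obtain ⟨x, r, hr⟩ := hg.exists_le_coe
  refine ne_bot_of_le_ne_bot ?_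
    ((EReal.sub_le_sub le_rfl hr).trans (le_iSup (fun x => (↑(∑ i, x i * y i) : EReal) - g x) x))
  rw [← EReal.coe_sub]
  exact EReal.coe_ne_bot _

theorem EProper.conjR_ne_bot {g : ℝ → EReal} (hg : EProper g) (y : ℝ) : conjR g y ≠ ⊥ := by
  obtain ⟨x, r, hr⟩ := hg.exists_le_coe
  refine ne_bot_of_le_ne_bot ?_
    ((EReal.sub_le_sub le_rfl hr).trans (le_iSup (fun x => (↑(x * y) : EReal) - g x) x))
  rw [← EReal.coe_sub]
  exact EReal.coe_ne_bot _

/-- Fenchel–Young inequality. -/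
theorem sub_le_of_conjFn_le {d : Type*} [Fintype d] {g : (d → ℝ) → EReal} {x y : d → ℝ} {b c : ℝ}
    (hb : conjFn g y ≤ b) (hc : g x ≤ c) : ∑ i, x i * y i - c ≤ b := by
  have := (EReal.sub_le_sub le_rfl hc).trans
    ((le_iSup (fun x => (↑(∑ i, x i * y i) : EReal) - g x) x).trans hb)
  exact_mod_cast this

theorem sub_le_of_conjR_le {g : ℝ → EReal} {x y b c : ℝ}
    (hb : conjR g y ≤ b) (hc : g x ≤ c) : x * y - c ≤ b := by
  have := (EReal.sub_le_sub le_rfl hc).trans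
    ((le_iSup (fun x => (↑(x * y) : EReal) - g x) x).trans hb)
  exact_mod_cast this

theorem conjFn_le_coe {d : Type*} [Fintype d] {g : (d → ℝ) → EReal} (hg : ∀ x, g x ≠ ⊥)
    {y : d → ℝ} {b : ℝ} (h : ∀ (x : d → ℝ) (c : ℝ), g x ≤ c → ∑ i, x i * y i - c ≤ b) :
    conjFn g y ≤ b := by
  refine iSup_le fun x => ?_
  by_cases hx : g x = ⊤
  · simp [hx]
  · obtain ⟨r, hr⟩ := EReal.exists_coe_eq hx (hg x)
    have := h x r hr.le
    rw [hr]
    exact_mod_cast this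

/-! ### Perspective functions -/

theorem persp_le_coe_iff {d : Type*} [Fintype d] {h : (d → ℝ) → EReal} {θ c : ℝ} {x : d → ℝ} :
    persp h θ x ≤ c ↔
      (0 < θ ∧ h (θ⁻¹ • x) ≤ ((c / θ : ℝ) : EReal)) ∨ (θ = 0 ∧ x = 0 ∧ 0 ≤ c) := by
  unfold persp
  by_cases hθ : 0 < θ
  · rw [if_pos hθ, EReal.coe_div, EReal.le_div_iff_mul_le (by exact_mod_cast hθ)
      (EReal.coe_ne_top θ), mul_comm]
    simp [hθ, hθ.ne']
  · rw [if_neg hθ]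
    split_ifs with h0
    · simp [h0.1, h0.2]
    · simp only [top_le_iff, EReal.coe_ne_top, hθ, false_and, false_or, false_iff]
      exact fun h => h0 ⟨h.1, h.2.1⟩

theorem persp_ne_bot {d : Type*} [Fintype d] {h : (d → ℝ) → EReal} (hh : ∀ x, h x ≠ ⊥)
    (θ : ℝ) (x : d → ℝ) : persp h θ x ≠ ⊥ := by
  unfold persp
  split_ifs with hθ h0
  · have hθ' : (0 : EReal) < θ := by exact_mod_cast hθ
    by_cases ht : h (θ⁻¹ • x) = ⊤
    · rw [ht, EReal.mul_top_of_pos hθ']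
      exact top_ne_bot
    · obtain ⟨r, hr⟩ := EReal.exists_coe_eq ht (hh _)
      rw [hr, ← EReal.coe_mul]
      exact EReal.coe_ne_bot _
  · exact EReal.zero_ne_bot
  · exact top_ne_bot

theorem persp_smul_le {d : Type*} [Fintype d] {h : (d → ℝ) → EReal} {θ c a : ℝ} {x : d → ℝ}
    (ha : 0 ≤ a) (hc : persp h θ x ≤ c) : persp h (a * θ) (a • x) ≤ ((a * c : ℝ) : EReal) := by
  rcases ha.eq_or_lt with rfl | ha
  · simp [persp]
  rw [persp_le_coe_iff] at hc ⊢
  rcases hc with ⟨hθ, hc⟩ | ⟨rfl, rfl, hc⟩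
  · refine .inl ⟨by positivity, ?_⟩
    rwa [smul_smul, show (a * θ)⁻¹ * a = θ⁻¹ by field_simp, mul_div_mul_left _ _ ha.ne']
  · exact .inr ⟨by simp, by simp, by positivity⟩

theorem persp_add_le {d : Type*} [Fintype d] {h : (d → ℝ) → EReal} (hh : EConvexOn h)
    {θ θ' c c' : ℝ} {x x' : d → ℝ} (hc : persp h θ x ≤ c) (hc' : persp h θ' x' ≤ c') :
    persp h (θ + θ') (x + x') ≤ ((c + c' : ℝ) : EReal) := by
  have hc₀ := hc
  have hc₀' := hc'
  rw [persp_le_coe_iff] at hc hc'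
  rcases hc with ⟨hθ, hc⟩ | ⟨rfl, rfl, hc⟩
  · rcases hc' with ⟨hθ', hc'⟩ | ⟨rfl, rfl, hc'⟩
    · rw [persp_le_coe_iff]
      refine .inl ⟨by positivity, ?_⟩
      have key := hh.le_coe (a := θ / (θ + θ')) (b := θ' / (θ + θ')) (by positivity)
        (by positivity) (by field_simp) hc hc'
      have e₁ : (θ / (θ + θ')) • θ⁻¹ • x + (θ' / (θ + θ')) • θ'⁻¹ • x' =
          (θ + θ')⁻¹ • (x + x') := by
        rw [smul_smul, smul_smul, smul_add]
        congr 2 <;> field_simp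
      have e₂ : θ / (θ + θ') * (c / θ) + θ' / (θ + θ') * (c' / θ') = (c + c') / (θ + θ') := by
        field_simp
      rwa [e₁, e₂] at key
    · rw [add_zero, add_zero]
      exact hc₀.trans (by exact_mod_cast le_add_of_nonneg_right hc')
  · rw [zero_add, zero_add]
    exact hc₀'.trans (by exact_mod_cast le_add_of_nonneg_left hc)

theorem persp_convex_le {d : Type*} [Fintype d] {h : (d → ℝ) → EReal} (hh : EConvexOn h)
    {θ θ' c c' a b : ℝ} {x x' : d → ℝ} (ha : 0 ≤ a) (hb : 0 ≤ b)
    (hc : persp h θ x ≤ c) (hc' : persp h θ' x' ≤ c') :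
    persp h (a * θ + b * θ') (a • x + b • x') ≤ ((a * c + b * c' : ℝ) : EReal) :=
  persp_add_le hh (persp_smul_le ha hc) (persp_smul_le hb hc')

/-! ### The epigraph of the perturbed primal problem -/

/-- `lam`, `p`, `f` are real upper bounds of the individual terms of `Fobj ℓ F φ c`. -/
def TermBounds (ℓ : LSp T n) (F : FSp T n) (φ : PhiSp T) (c : Csp T n)
    (lam : Fin T → Fin n → ℝ) (p : Fin T → ℝ) (f : Fin (T + 1) → ℝ) : Prop :=
  (∀ t x, persp (ℓ t x) (c.1 t.castSucc x) (c.2.1 t x) ≤ lam t x) ∧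
    (∀ t, φ t (c.2.2.2 t) ≤ p t) ∧ ∀ s, F s (c.2.2.1 s) ≤ f s

/-- Pairs (perturbation of the constraints, cost bound) reachable in the primal problem. -/
def perturbEpi (ℓ : LSp T n) (F : FSp T n) (φ : PhiSp T) (α : ASp T n) (m0 : Fin n → ℝ) :
    Set (Ksp T n × ℝ) :=
  {z | ∃ c lam p f, TermBounds ℓ F φ c lam p f ∧ z.1 = Aop α c + (mbar0 m0, 0, 0) ∧
    z.2 = (∑ t, ∑ x, lam t x) + ∑ t, p t + ∑ s, f s}

theorem opS_zero (w : Wsp T n) (x : Fin n) : opS w 0 x = 0 := by simp [opS]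

theorem opS_succ (w : Wsp T n) (t : Fin T) (x : Fin n) : opS w t.succ x = ∑ y, w t y x := by
  simp [opS]

theorem Aop_convex_comb (α : ASp T n) (c c' : Csp T n) (a b : ℝ) :
    Aop α (a • c + b • c') = a • Aop α c + b • Aop α c' := by
  refine Prod.ext ?_ (Prod.ext ?_ ?_)
  · funext s x
    simp only [Aop, opS, Prod.fst_add, Prod.snd_add, Prod.smul_fst, Prod.smul_snd, Pi.add_apply,
      Pi.smul_apply, smul_eq_mul]
    split_ifs
    · ring
    · rw [Finset.sum_add_distrib, ← Finset.mul_sum, ← Finset.mul_sum]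
      ring
  · funext s x
    simp only [Aop, Prod.fst_add, Prod.snd_add, Prod.smul_fst, Prod.smul_snd, Pi.add_apply,
      Pi.smul_apply, smul_eq_mul]
    ring
  · funext t
    simp only [Aop, opA, Prod.fst_add, Prod.snd_add, Prod.smul_fst, Prod.smul_snd, Pi.add_apply,
      Pi.smul_apply, smul_eq_mul, add_mul, Finset.sum_add_distrib, mul_assoc, ← Finset.mul_sum]
    ring

theorem convex_perturbEpi {ℓ : LSp T n} {F : FSp T n} {φ : PhiSp T} (α : ASp T n)
    (m0 : Fin n → ℝ) (hconv : ConvAssumption ℓ F φ) : Convex ℝ (perturbEpi ℓ F φ α m0) := by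
  rintro ⟨k, r⟩ ⟨c, lam, p, f, ⟨h₁, h₂, h₃⟩, rfl, rfl⟩ ⟨k', r'⟩
    ⟨c', lam', p', f', ⟨h₁', h₂', h₃'⟩, rfl, rfl⟩ a b ha hb hab
  refine ⟨a • c + b • c', a • lam + b • lam', a • p + b • p', a • f + b • f', ⟨?_, ?_, ?_⟩,
    ?_, ?_⟩
  · exact fun t x => persp_convex_le (hconv.1 t x).2.1 ha hb (h₁ t x) (h₁' t x)
  · exact fun t => (hconv.2.2 t).2.1.le_coe ha hb hab (h₂ t) (h₂' t)
  · exact fun s => (hconv.2.1 s).2.1.le_coe ha hb hab (h₃ s) (h₃' s)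
  · rw [Aop_convex_comb]
    simp only [Prod.fst_add, Prod.smul_fst, smul_add]
    have : ((mbar0 m0, 0, 0) : Ksp T n) = a • (mbar0 m0, 0, 0) + b • (mbar0 m0, 0, 0) := by
      rw [← add_smul, hab, one_smul]
    rw [add_add_add_comm, ← this]
  · simp only [Prod.snd_add, Prod.smul_snd, Pi.add_apply, Pi.smul_apply, smul_eq_mul,
      Finset.sum_add_distrib, ← Finset.mul_sum]
    ring

theorem kpair_Aop (α : ASp T n) (k : Ksp T n) (c : Csp T n) :
    kpair k (Aop α c) = cpair c (AstarOp α k) := by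
  have hS : ∑ s, ∑ x, k.1 s x * opS c.2.1 s x =
      ∑ t : Fin T, ∑ x, ∑ y, c.2.1 t x y * k.1 t.succ y := by
    rw [Fin.sum_univ_succ]
    simp only [opS_zero, opS_succ, mul_zero, Finset.sum_const_zero, zero_add]
    refine Finset.sum_congr rfl fun t _ => ?_
    simp only [Finset.mul_sum]
    rw [Finset.sum_comm]
    simp only [mul_comm]
  have hA : ∑ t, k.2.2 t * opA α c.2.1 t =
      ∑ t : Fin T, ∑ x, ∑ y, c.2.1 t x y * (α t x y * k.2.2 t) := by
    simp only [opA, Finset.mul_sum]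
    exact Finset.sum_congr rfl fun t _ => Finset.sum_congr rfl fun x _ =>
      Finset.sum_congr rfl fun y _ => by ring
  simp only [kpair, cpair, Aop, AstarOp, mul_sub, mul_add, mul_neg, Finset.sum_sub_distrib,
    Finset.sum_add_distrib, Finset.sum_neg_distrib, hS, hA, mul_comm (k.1 _ _) (c.1 _ _),
    mul_comm (k.2.1 _ _) (c.1 _ _), mul_comm (k.2.1 _ _) (c.2.2.1 _ _),
    mul_comm (k.2.2 _) (c.2.2.2 _)]
  ring

theorem kpair_add_mbar0 (m0 : Fin n → ℝ) (k k' : Ksp T n) :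
    kpair k (k' + (mbar0 m0, 0, 0)) = kpair k k' + ∑ x, m0 x * k.1 0 x := by
  have : ∑ s, ∑ x, k.1 s x * mbar0 m0 s x = ∑ x, m0 x * k.1 0 x := by
    rw [Fin.sum_univ_succ]
    simp [mbar0, Fin.succ_ne_zero, mul_comm]
  simp only [kpair, Prod.fst_add, Prod.snd_add, Pi.add_apply, mul_add, Finset.sum_add_distrib,
    Pi.zero_apply, add_zero, this]
  ring

/-- The pairing of a dual variable with a reachable perturbation, stage by stage. -/
theorem kpair_perturbation (α : ASp T n) (m0 : Fin n → ℝ) (k : Ksp T n) (c : Csp T n) :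
    kpair k (Aop α c + (mbar0 m0, 0, 0)) =
      (∑ t : Fin T, ∑ x, (c.1 t.castSucc x * (k.2.1 t.castSucc x - k.1 t.castSucc x) +
          ∑ y, c.2.1 t x y * (α t x y * k.2.2 t + k.1 t.succ y))) +
        (∑ x, c.1 (Fin.last T) x * (k.2.1 (Fin.last T) x - k.1 (Fin.last T) x)) -
        (∑ t, c.2.2.2 t * k.2.2 t) - (∑ s, ∑ x, c.2.2.1 s x * k.2.1 s x) +
        ∑ x, m0 x * k.1 0 x := by
  rw [kpair_add_mbar0, kpair_Aop, cpair]
  simp only [AstarOp]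
  rw [Fin.sum_univ_castSucc]
  simp only [Finset.sum_add_distrib, mul_neg, Finset.sum_neg_distrib]
  ring

/-! ### Weak duality -/

theorem Dobj_le_of_mem_perturbEpi {ℓ : LSp T n} {F : FSp T n} {φ : PhiSp T} {α : ASp T n}
    {m0 : Fin n → ℝ} (hconv : ConvAssumption ℓ F φ) {k : Ksp T n} (hk : FeasD ℓ α k)
    {z : Ksp T n × ℝ} (hz : z ∈ perturbEpi ℓ F φ α m0) :
    Dobj F φ m0 k ≤ ((z.2 + kpair k z.1 : ℝ) : EReal) := by
  obtain ⟨c, lam, p, f, ⟨h₁, h₂, h₃⟩, hz₁, hz₂⟩ := hz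
  have hφb : ∀ t, conjR (φ t) (k.2.2 t) ≠ ⊥ := fun t => (hconv.2.2 t).1.conjR_ne_bot _
  have hFb : ∀ s, conjFn (F s) (k.2.1 s) ≠ ⊥ := fun s => (hconv.2.1 s).1.conjFn_ne_bot _
  by_cases hφt : ∑ t, conjR (φ t) (k.2.2 t) = ⊤
  · simp [Dobj, hφt]
  by_cases hFt : ∑ s, conjFn (F s) (k.2.1 s) = ⊤
  · simp [Dobj, hFt]
  obtain ⟨b, hb⟩ := EReal.exists_coe_eq_of_sum hφb hφt
  obtain ⟨g, hg⟩ := EReal.exists_coe_eq_of_sum hFb hFt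
  simp only [Dobj, hb, hg]
  rw [← EReal.coe_sum_fintype, ← EReal.coe_sum_fintype, ← EReal.coe_sub, ← EReal.coe_sub,
    EReal.coe_le_coe_iff, hz₁, hz₂, kpair_perturbation]
  have hφ : ∑ t, c.2.2.2 t * k.2.2 t - ∑ t, p t ≤ ∑ t, b t := by
    rw [← Finset.sum_sub_distrib]
    exact Finset.sum_le_sum fun t _ => sub_le_of_conjR_le (hb t).le (h₂ t)
  have hF : ∑ s, ∑ x, c.2.2.1 s x * k.2.1 s x - ∑ s, f s ≤ ∑ s, g s := by
    rw [← Finset.sum_sub_distrib]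
    exact Finset.sum_le_sum fun s _ => sub_le_of_conjFn_le (hg s).le (h₃ s)
  have hlast : ∑ x, c.1 (Fin.last T) x * (k.2.1 (Fin.last T) x - k.1 (Fin.last T) x) = 0 :=
    Finset.sum_eq_zero fun x _ => by rw [hk.2 x, sub_self, mul_zero]
  have hstage : 0 ≤ ∑ t : Fin T, ∑ x, lam t x +
      ∑ t : Fin T, ∑ x, (c.1 t.castSucc x * (k.2.1 t.castSucc x - k.1 t.castSucc x) +
          ∑ y, c.2.1 t x y * (α t x y * k.2.2 t + k.1 t.succ y)) := by
    rw [← Finset.sum_add_distrib]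
    refine Finset.sum_nonneg fun t _ => ?_
    rw [← Finset.sum_add_distrib]
    refine Finset.sum_nonneg fun x _ => ?_
    rcases persp_le_coe_iff.1 (h₁ t x) with ⟨hθ, hl⟩ | ⟨hθ, hw, hl⟩
    · have hd : dpCost ℓ α k.1 k.2.2 t x ≤
          ((k.2.1 t.castSucc x - k.1 t.castSucc x : ℝ) : EReal) := by
        rw [EReal.coe_sub, EReal.le_sub_iff_add_le (by simp) (by simp), add_comm]
        exact hk.1 t x
      have hy := sub_le_of_conjFn_le hd hl
      simp only [Pi.smul_apply, smul_eq_mul, mul_neg, Finset.sum_neg_distrib, mul_assoc,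
        ← Finset.mul_sum] at hy
      have := mul_le_mul_of_nonneg_left hy hθ.le
      field_simp at this
      linarith
    · simp [hθ, hw, hl]
  linarith

/-! ### Supporting functionals are dual solutions -/

theorem persp_zero_zero {d : Type*} [Fintype d] (h : (d → ℝ) → EReal) : persp h 0 0 = 0 := by
  simp [persp]

/-- An affine function bounded below on the positive half-line has nonnegative slope. -/
theorem nonneg_of_forall_le_add_mul {v a b : ℝ} (h : ∀ θ : ℝ, 0 < θ → v ≤ a + θ * b) : 0 ≤ b := by
  by_contra! hb
  have := h ((|a - v| + 1) / (-b)) (div_pos (by positivity) (by linarith))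
  have e : (|a - v| + 1) / (-b) * b = -(|a - v| + 1) := by
    rw [div_neg, neg_mul, div_mul_cancel₀ _ hb.ne]
  rw [e] at this
  linarith [le_abs_self (a - v)]

theorem le_of_supporting {ℓ : LSp T n} {F : FSp T n} {φ : PhiSp T} {α : ASp T n}
    {m0 : Fin n → ℝ} {k : Ksp T n} {v : ℝ}
    (hk : ∀ z ∈ perturbEpi ℓ F φ α m0, v ≤ z.2 + kpair k z.1)
    (c : Csp T n) (lam : Fin T → Fin n → ℝ) (p : Fin T → ℝ) (f : Fin (T + 1) → ℝ)
    (h : TermBounds ℓ F φ c lam p f) :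
    v ≤ (∑ t : Fin T, ∑ x, (lam t x + c.1 t.castSucc x * (k.2.1 t.castSucc x - k.1 t.castSucc x) +
          ∑ y, c.2.1 t x y * (α t x y * k.2.2 t + k.1 t.succ y))) +
        (∑ x, c.1 (Fin.last T) x * (k.2.1 (Fin.last T) x - k.1 (Fin.last T) x)) +
        (∑ t, (p t - c.2.2.2 t * k.2.2 t)) + (∑ s, (f s - ∑ x, c.2.2.1 s x * k.2.1 s x)) +
        ∑ x, m0 x * k.1 0 x := by
  have := hk (_, _) ⟨c, lam, p, f, h, rfl, rfl⟩
  rw [kpair_perturbation] at this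
  simp only [Finset.sum_add_distrib, Finset.sum_sub_distrib] at this ⊢
  linarith

theorem feasD_of_supporting {ℓ : LSp T n} {F : FSp T n} {φ : PhiSp T} {α : ASp T n}
    {m0 : Fin n → ℝ} (hconv : ConvAssumption ℓ F φ) {k : Ksp T n} {v : ℝ}
    (hk : ∀ z ∈ perturbEpi ℓ F φ α m0, v ≤ z.2 + kpair k z.1) : FeasD ℓ α k := by
  choose D p hp using fun t => (hconv.2.2 t).1.exists_le_coe
  choose m2 f hf using fun s => (hconv.2.1 s).1.exists_le_coe
  set a : ℝ := (∑ t, (p t - D t * k.2.2 t)) + (∑ s, (f s - ∑ x, m2 s x * k.2.1 s x)) +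
    ∑ x, m0 x * k.1 0 x with ha
  refine ⟨fun t x => ?_, fun x => ?_⟩
  · rw [add_comm, ← EReal.le_sub_iff_add_le (by simp) (by simp), ← EReal.coe_sub]
    refine conjFn_le_coe (hconv.1 t x).1.2 fun ρ l hl => ?_
    have key : 0 ≤ l + (k.2.1 t.castSucc x - k.1 t.castSucc x) +
        ∑ y, ρ y * (α t x y * k.2.2 t + k.1 t.succ y) := by
      refine nonneg_of_forall_le_add_mul (v := v) (a := a) fun θ hθ => ?_
      have h := le_of_supporting hk
        (Pi.single t.castSucc (Pi.single x θ), Pi.single t (Pi.single x (θ • ρ)), m2, D)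
        (Pi.single t (Pi.single x (θ * l))) p f ⟨fun t' x' => ?_, hp, hf⟩
      · simp only [Pi.single_apply, Fin.castSucc_inj] at h
        rw [Finset.sum_eq_single t (fun t' _ ht' => by simp [ht']) (by simp),
          Finset.sum_eq_single x (fun x' _ hx' => by simp [hx']) (by simp)] at h
        simp only [if_true, Pi.single_eq_same, Pi.smul_apply, smul_eq_mul, mul_assoc,
          ← Finset.mul_sum, (Fin.castSucc_ne_last t).symm, if_false, Pi.zero_apply, zero_mul,
          Finset.sum_const_zero] at h
        linarith
      · by_cases ht : t' = t
        · subst ht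
          by_cases hx : x' = x
          · subst hx
            simp only [Pi.single_eq_same]
            refine persp_le_coe_iff.2 (.inl ⟨hθ, ?_⟩)
            rwa [inv_smul_smul₀ hθ.ne', mul_div_cancel_left₀ _ hθ.ne']
          · simp [Pi.single_eq_same, Pi.single_eq_of_ne hx, persp_zero_zero]
        · simp [ht, persp_zero_zero]
    simp only [mul_neg, Finset.sum_neg_distrib]
    linarith
  · have hpm : ∀ ε : ℝ, 0 ≤ ε * (k.2.1 (Fin.last T) x - k.1 (Fin.last T) x) := by
      intro ε
      refine nonneg_of_forall_le_add_mul (v := v) (a := a) fun θ _ => ?_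
      have h := le_of_supporting hk
        (Pi.single (Fin.last T) (Pi.single x (θ * ε)), 0, m2, D) 0 p f
        ⟨fun t' x' => ?_, hp, hf⟩
      · simp only [Pi.single_eq_same, Pi.single_apply, Fin.castSucc_ne_last, if_false,
          Pi.zero_apply, zero_mul, Finset.sum_const_zero, add_zero, ite_mul, zero_add,
          Finset.sum_ite_eq', Finset.mem_univ, if_true, ← mul_assoc] at h ⊢
        linarith
      · simp [Fin.castSucc_ne_last, persp_zero_zero]
    have h₁ := hpm 1
    have h₂ := hpm (-1)
    linarith

theorem le_Dobj_of_supporting {ℓ : LSp T n} {F : FSp T n} {φ : PhiSp T} {α : ASp T n}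
    {m0 : Fin n → ℝ} (hconv : ConvAssumption ℓ F φ) {k : Ksp T n} {v : ℝ}
    (hk : ∀ z ∈ perturbEpi ℓ F φ α m0, v ≤ z.2 + kpair k z.1) : (v : EReal) ≤ Dobj F φ m0 k := by
  have hφb : ∑ t, conjR (φ t) (k.2.2 t) ≠ ⊥ :=
    EReal.sum_ne_bot fun t _ => (hconv.2.2 t).1.conjR_ne_bot _
  have hFb : ∑ s, conjFn (F s) (k.2.1 s) ≠ ⊥ :=
    EReal.sum_ne_bot fun s _ => (hconv.2.1 s).1.conjFn_ne_bot _
  have hsum : ∑ t, conjR (φ t) (k.2.2 t) + ∑ s, conjFn (F s) (k.2.1 s) ≤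
      ((∑ x, m0 x * k.1 0 x - v : ℝ) : EReal) := by
    refine EReal.add_le_of_forall_lt fun p' hp' f' hf' => ?_
    obtain ⟨D, hD⟩ := EReal.exists_lt_sum_of_lt_sum_iSup Finset.univ
      (fun t x => (↑(x * k.2.2 t) : EReal) - φ t x) p' hp'
    obtain ⟨m2, hm2⟩ := EReal.exists_lt_sum_of_lt_sum_iSup Finset.univ
      (fun s (x : Fin n → ℝ) => (↑(∑ i, x i * k.2.1 s i) : EReal) - F s x) f' hf'
    have hDt : ∀ t, φ t (D t) ≠ ⊤ := fun t ht =>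
      EReal.ne_bot_of_sum_ne_bot (ne_bot_of_gt hD) t (Finset.mem_univ t) (by simp [ht])
    have hFt : ∀ s, F s (m2 s) ≠ ⊤ := fun s hs =>
      EReal.ne_bot_of_sum_ne_bot (ne_bot_of_gt hm2) s (Finset.mem_univ s) (by simp [hs])
    choose p hp using fun t => EReal.exists_coe_eq (hDt t) ((hconv.2.2 t).1.2 _)
    choose f hf using fun s => EReal.exists_coe_eq (hFt s) ((hconv.2.1 s).1.2 _)
    have h := le_of_supporting hk (0, 0, m2, D) 0 p f
      ⟨fun t x => by simp [persp_zero_zero], fun t => (hp t).le, fun s => (hf s).le⟩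
    simp only [Pi.zero_apply, zero_mul, Finset.sum_const_zero, add_zero, zero_add,
      Finset.sum_sub_distrib] at h
    refine (add_le_add hD.le hm2.le).trans ?_
    simp only [hp, hf, ← EReal.coe_sub, ← EReal.coe_sum_fintype]
    rw [← EReal.coe_add, EReal.coe_le_coe_iff, Finset.sum_sub_distrib, Finset.sum_sub_distrib]
    linarith
  have hφt : ∑ t, conjR (φ t) (k.2.2 t) ≠ ⊤ := by
    intro h
    rw [h, EReal.top_add_of_ne_bot hFb] at hsum
    exact EReal.coe_ne_top _ (top_le_iff.1 hsum)
  have hFt : ∑ s, conjFn (F s) (k.2.1 s) ≠ ⊤ := by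
    intro h
    rw [h, EReal.add_top_of_ne_bot hφb] at hsum
    exact EReal.coe_ne_top _ (top_le_iff.1 hsum)
  obtain ⟨b, hb⟩ := EReal.exists_coe_eq hφt hφb
  obtain ⟨g, hg⟩ := EReal.exists_coe_eq hFt hFb
  rw [hb, hg, ← EReal.coe_add, EReal.coe_le_coe_iff] at hsum
  rw [Dobj, hb, hg, ← EReal.coe_sub, ← EReal.coe_sub, EReal.coe_le_coe_iff]
  linarith

/-! ### Qualification: small perturbations have finite cost -/

theorem exists_pos_smul_mem_perturbEpi {ℓ : LSp T n} {F : FSp T n} {φ : PhiSp T} {α : ASp T n}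
    {m0 : Fin n → ℝ} (hconv : ConvAssumption ℓ F φ) (hqual : Qualif ℓ F φ α m0) (k : Ksp T n) :
    ∃ δ : ℝ, 0 < δ ∧ ∃ r, (δ • k, r) ∈ perturbEpi ℓ F φ α m0 := by
  obtain ⟨α0, hα0, hq⟩ := hqual
  set Q : ℝ := (∑ s, ∑ x, k.1 s x ^ 2) + (∑ s, ∑ x, k.2.1 s x ^ 2) + ∑ t, k.2.2 t ^ 2 with hQ
  have hQ0 : 0 ≤ Q := by positivity
  set δ : ℝ := α0 / (1 + Q) with hδ
  have hδ0 : 0 < δ := by positivity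
  set ε1 : Msp T n := fun s x => if s = 0 then -(δ * k.1 s x) else δ * k.1 s x with hε1
  set ε2 : Msp T n := fun s x => -(δ * k.2.1 s x) with hε2
  set ε3 : Psp T := fun t => -(δ * k.2.2 t) with hε3
  have hnorm : qnorm ε1 ε2 ε3 ≤ α0 := by
    have e : ∀ s x, ε1 s x ^ 2 = δ ^ 2 * k.1 s x ^ 2 := by
      intro s x
      simp only [hε1]
      split_ifs <;> ring
    rw [qnorm]
    refine Real.sqrt_le_iff.2 ⟨hα0.le, ?_⟩
    simp only [e, hε2, hε3, neg_sq, mul_pow, ← Finset.mul_sum]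
    rw [← mul_add, ← mul_add, ← hQ, hδ, div_pow, div_mul_eq_mul_div, div_le_iff₀ (by positivity)]
    exact mul_le_mul_of_nonneg_left (by nlinarith) (by positivity)
  obtain ⟨π, hπ, m1, ⟨hm0, hms⟩, hpos, hF, hφ⟩ := hq ε1 ε2 ε3 hnorm
  choose l hl using fun t x => EReal.exists_coe_eq (hπ t x) ((hconv.1 t x).1.2 _)
  choose f hf using fun s => EReal.exists_coe_eq (hF s) ((hconv.2.1 s).1.2 _)
  choose p hp using fun t => EReal.exists_coe_eq (hφ t) ((hconv.2.2 t).1.2 _)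
  refine ⟨δ, hδ0, _, (m1, fun t x y => m1 t.castSucc x * π t x y, fun s x => m1 s x + ε2 s x,
    fun t => Qcpl α m1 π t + ε3 t), fun t x => m1 t.castSucc x * l t x, p, f,
    ⟨fun t x => ?_, fun t => (hp t).le, fun s => (hf s).le⟩, ?_, rfl⟩
  · rcases (hpos t.castSucc x).eq_or_lt with h | h
    · refine persp_le_coe_iff.2 (.inr ⟨h.symm, ?_, by simp [← h]⟩)
      funext y
      simp [← h]
    · refine persp_le_coe_iff.2 (.inl ⟨h, ?_⟩)
      rw [mul_div_cancel_left₀ _ h.ne', ← hl t x]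
      refine le_of_eq (congrArg _ ?_)
      funext y
      simp [inv_mul_cancel_left₀ h.ne']
  · refine Prod.ext ?_ (Prod.ext ?_ ?_)
    · funext s x
      refine Fin.cases ?_ (fun t => ?_) s
      · have := hm0 x
        simp only [Aop, Prod.fst_add, Prod.smul_fst, Pi.add_apply, Pi.smul_apply, smul_eq_mul,
          opS_zero, this, hε1, if_true]
        ring
      · have := hms t x
        simp only [Aop, Prod.fst_add, Prod.smul_fst, Pi.add_apply, Pi.smul_apply, smul_eq_mul,
          opS_succ, this, hε1, Fin.succ_ne_zero, if_false, mbar0]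
        ring
    · funext s x
      simp [Aop, hε2]
    · funext t
      simp [Aop, hε3, opA, Qcpl]

/-! ### Lower bound on the primal problem -/

theorem simplex_subset_Icc : simplex n ⊆ Set.Icc (0 : Fin n → ℝ) 1 :=
  fun _ hρ => ⟨fun y => (hρ.1 y).1, fun y => (hρ.1 y).2⟩

theorem mass_of_persp_le {h : (Fin n → ℝ) → EReal} (hdom : ∀ ρ, h ρ ≠ ⊤ → ρ ∈ simplex n)
    {L : ℝ} (hL : ∀ ρ ∈ Set.Icc (0 : Fin n → ℝ) 1, (L : EReal) ≤ h ρ) {θ c : ℝ} {x : Fin n → ℝ}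
    (hc : persp h θ x ≤ c) : (∀ y, 0 ≤ x y) ∧ ∑ y, x y = θ ∧ L * θ ≤ c := by
  rcases persp_le_coe_iff.1 hc with ⟨hθ, hl⟩ | ⟨rfl, rfl, h0⟩
  · have hs := hdom _ (ne_top_of_le_ne_top (EReal.coe_ne_top _) hl)
    refine ⟨fun y => ?_, ?_, ?_⟩
    · have := (hs.1 y).1
      rw [Pi.smul_apply, smul_eq_mul] at this
      exact (mul_nonneg_iff_of_pos_left (inv_pos.2 hθ)).1 this
    · have := hs.2
      simp only [Pi.smul_apply, smul_eq_mul, ← Finset.mul_sum] at this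
      field_simp at this
      exact this
    · have := (hL _ (simplex_subset_Icc hs)).trans hl
      rwa [EReal.coe_le_coe_iff, le_div_iff₀ hθ] at this
  · simpa using h0

theorem exists_lower_bound_perturbEpi {ℓ : LSp T n} {F : FSp T n} {φ : PhiSp T} (α : ASp T n)
    {m0 : Fin n → ℝ} (hm0 : m0 ∈ simplex n) (hconv : ConvAssumption ℓ F φ) :
    ∃ L : ℝ, ∀ r, ((0 : Ksp T n), r) ∈ perturbEpi ℓ F φ α m0 → L ≤ r := by
  choose Ll hLl using fun t x => (hconv.1 t x).2.2.1.exists_coe_le (hconv.1 t x).1.2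
    (isCompact_Icc (a := (0 : Fin n → ℝ)) (b := 1))
  choose LF hLF using fun s => (hconv.2.1 s).2.2.exists_coe_le (hconv.2.1 s).1.2
    (isCompact_Icc (a := (0 : Fin n → ℝ)) (b := 1))
  choose Lφ hLφ using fun t => (hconv.2.2 t).2.2.exists_coe_le (hconv.2.2 t).1.2
    (isCompact_Icc (a := -∑ x, ∑ y, |α t x y|) (b := ∑ x, ∑ y, |α t x y|))
  refine ⟨(∑ t, ∑ x, -|Ll t x|) + ∑ t, Lφ t + ∑ s, LF s, ?_⟩
  rintro r ⟨c, lam, p, f, ⟨h₁, h₂, h₃⟩, hz, rfl⟩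
  have hw := fun t x => mass_of_persp_le (hconv.1 t x).2.2.2 (hLl t x) (h₁ t x)
  have hm : ∀ s x, c.1 s x = opS c.2.1 s x + mbar0 m0 s x := fun s x => by
    have := congrFun (congrFun (congrArg Prod.fst hz) s) x
    simp only [Aop, Prod.fst_zero, Pi.zero_apply, Prod.fst_add, Pi.add_apply] at this
    linarith
  have hm2 : c.2.2.1 = c.1 := by
    funext s x
    have := congrFun (congrFun (congrArg (fun k => k.2.1) hz) s) x
    simp only [Aop, Prod.fst_zero, Prod.snd_zero, Pi.zero_apply, Prod.fst_add, Prod.snd_add,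
      Pi.add_apply] at this
    linarith
  have hD : ∀ t, c.2.2.2 t = opA α c.2.1 t := fun t => by
    have := congrFun (congrArg (fun k => k.2.2) hz) t
    simp only [Aop, Prod.snd_zero, Pi.zero_apply, Prod.snd_add, Pi.add_apply] at this
    linarith
  have hmass : ∀ s, (∀ x, 0 ≤ c.1 s x) ∧ ∑ x, c.1 s x = 1 := by
    intro s
    induction s using Fin.induction with
    | zero =>
      have e : ∀ x, c.1 0 x = m0 x := fun x => by simp [hm, opS_zero, mbar0]
      simp only [e]
      exact ⟨fun x => (hm0.1 x).1, hm0.2⟩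
    | succ t ih =>
      have e : ∀ x, c.1 t.succ x = ∑ y, c.2.1 t y x := fun x => by
        simp [hm, opS_succ, mbar0, Fin.succ_ne_zero]
      simp only [e]
      refine ⟨fun x => Finset.sum_nonneg fun y _ => (hw t y).1 x, ?_⟩
      rw [Finset.sum_comm]
      simp only [(hw t _).2.1, ih.2]
  have hm1 : ∀ s x, c.1 s x ≤ 1 := fun s x =>
    (hmass s).2 ▸ Finset.single_le_sum (fun y _ => (hmass s).1 y) (Finset.mem_univ x)
  have hw1 : ∀ t x y, c.2.1 t x y ≤ 1 := fun t x y =>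
    (Finset.single_le_sum (fun y _ => (hw t x).1 y) (Finset.mem_univ y)).trans
      ((hw t x).2.1.trans_le (hm1 _ _))
  refine add_le_add (add_le_add ?_ ?_) ?_
  · refine Finset.sum_le_sum fun t _ => Finset.sum_le_sum fun x _ => le_trans ?_ (hw t x).2.2
    have h0 := (hmass t.castSucc).1 x
    have h1 := hm1 t.castSucc x
    nlinarith [neg_abs_le (Ll t x), abs_nonneg (Ll t x)]
  · refine Finset.sum_le_sum fun t _ => ?_
    have hle : |c.2.2.2 t| ≤ ∑ x, ∑ y, |α t x y| := by
      rw [hD, opA]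
      refine (Finset.abs_sum_le_sum_abs _ _).trans (Finset.sum_le_sum fun x _ =>
        (Finset.abs_sum_le_sum_abs _ _).trans (Finset.sum_le_sum fun y _ => ?_))
      rw [abs_mul, abs_of_nonneg ((hw t x).1 y)]
      exact mul_le_of_le_one_left (abs_nonneg _) (hw1 t x y)
    exact_mod_cast (hLφ t _ (abs_le.1 hle)).trans (h₂ t)
  · refine Finset.sum_le_sum fun s _ => ?_
    exact_mod_cast (hLF s _ (hm2 ▸ ⟨fun x => (hmass s).1 x, fun x => hm1 s x⟩)).trans (h₃ s)

/-! ### The primal value as an infimum of reals -/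

theorem valPt_eq_sInf {ℓ : LSp T n} {F : FSp T n} {φ : PhiSp T} {α : ASp T n} {m0 : Fin n → ℝ}
    (hconv : ConvAssumption ℓ F φ)
    (hne : {r : ℝ | ((0 : Ksp T n), r) ∈ perturbEpi ℓ F φ α m0}.Nonempty)
    (hbdd : BddBelow {r : ℝ | ((0 : Ksp T n), r) ∈ perturbEpi ℓ F φ α m0}) :
    valPt ℓ F φ α m0 = (sInf {r : ℝ | ((0 : Ksp T n), r) ∈ perturbEpi ℓ F φ α m0} : ℝ) := by
  refine le_antisymm ?_ ?_
  · by_contra! hlt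
    obtain ⟨z, hz₁, hz₂⟩ := EReal.lt_iff_exists_real_btwn.1 hlt
    obtain ⟨r, hr, hrz⟩ := exists_lt_of_csInf_lt hne (EReal.coe_lt_coe_iff.1 hz₁)
    obtain ⟨c, lam, p, f, ⟨h₁, h₂, h₃⟩, hzero, rfl⟩ := hr
    have hm2 : c.2.2.1 = c.1 := by
      funext s x
      have := congrFun (congrFun (congrArg (fun k => k.2.1) hzero) s) x
      simp only [Aop, Prod.fst_zero, Prod.snd_zero, Pi.zero_apply, Prod.fst_add, Prod.snd_add,
        Pi.add_apply] at this
      linarith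
    have hD : c.2.2.2 = opA α c.2.1 := by
      funext t
      have := congrFun (congrArg (fun k => k.2.2) hzero) t
      simp only [Aop, Prod.snd_zero, Pi.zero_apply, Prod.snd_add, Pi.add_apply] at this
      linarith
    have hfeas : (c.1, c.2.1) ∈ {q : Msp T n × Wsp T n | FeasPt m0 q} := fun s x =>
      (congrFun (congrFun (congrArg Prod.fst hzero) s) x).symm
    have hJ : Jtil ℓ F φ α c.1 c.2.1 ≤
        (((∑ t, ∑ x, lam t x) + ∑ t, p t + ∑ s, f s : ℝ) : EReal) := by
      simp only [Jtil, EReal.coe_add, EReal.coe_sum_fintype]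
      refine add_le_add (add_le_add ?_ ?_) ?_
      · exact Finset.sum_le_sum fun t _ => Finset.sum_le_sum fun x _ => h₁ t x
      · exact Finset.sum_le_sum fun t _ => hD ▸ h₂ t
      · exact Finset.sum_le_sum fun s _ => hm2 ▸ h₃ s
    have := (iInf₂_le (f := fun (q : Msp T n × Wsp T n) _ => Jtil ℓ F φ α q.1 q.2) _ hfeas).trans
      (hJ.trans (EReal.coe_le_coe_iff.2 hrz.le))
    exact absurd hz₂ (not_lt.2 this)
  · refine le_iInf₂ fun q hq => ?_
    by_cases hJ : Jtil ℓ F φ α q.1 q.2 = ⊤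
    · rw [hJ]
      exact le_top
    have hb₁ : ∀ t x, persp (ℓ t x) (q.1 t.castSucc x) (q.2 t x) ≠ ⊥ := fun t x =>
      persp_ne_bot (hconv.1 t x).1.2 _ _
    have hb₁' : ∀ t, ∑ x, persp (ℓ t x) (q.1 t.castSucc x) (q.2 t x) ≠ ⊥ := fun t =>
      EReal.sum_ne_bot fun x _ => hb₁ t x
    have hB₁ := EReal.sum_ne_bot (s := Finset.univ) fun t _ => hb₁' t
    have hb₂ : ∀ t, φ t (opA α q.2 t) ≠ ⊥ := fun t => (hconv.2.2 t).1.2 _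
    have hB₂ := EReal.sum_ne_bot (s := Finset.univ) fun t _ => hb₂ t
    have hb₃ : ∀ s, F s (q.1 s) ≠ ⊥ := fun s => (hconv.2.1 s).1.2 _
    have hB₃ := EReal.sum_ne_bot (s := Finset.univ) fun s _ => hb₃ s
    have hT₃ : ∑ s, F s (q.1 s) ≠ ⊤ := fun h => hJ (by
      rw [Jtil, h, EReal.add_top_of_ne_bot (by simp [EReal.add_eq_bot_iff, hB₁, hB₂])])
    have hT₂ : ∑ t, φ t (opA α q.2 t) ≠ ⊤ := fun h => hJ (by
      rw [Jtil, h, EReal.add_top_of_ne_bot hB₁, EReal.top_add_of_ne_bot hB₃])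
    have hT₁ : ∑ t, ∑ x, persp (ℓ t x) (q.1 t.castSucc x) (q.2 t x) ≠ ⊤ := fun h => hJ (by
      rw [Jtil, h, EReal.top_add_of_ne_bot hB₂, EReal.top_add_of_ne_bot hB₃])
    obtain ⟨p, hp⟩ := EReal.exists_coe_eq_of_sum hb₂ hT₂
    obtain ⟨f, hf⟩ := EReal.exists_coe_eq_of_sum hb₃ hT₃
    choose lam hlam using fun t => EReal.exists_coe_eq_of_sum (hb₁ t)
      (EReal.ne_top_of_sum_ne_top (fun t _ => hb₁' t) hT₁ t (Finset.mem_univ t))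
    rw [Jtil]
    simp only [hp, hf, hlam, ← EReal.coe_sum_fintype, ← EReal.coe_add]
    refine EReal.coe_le_coe_iff.2 (csInf_le hbdd ⟨(q.1, q.2, q.1, opA α q.2), lam, p, f,
      ⟨fun t x => (hlam t x).le, fun t => (hp t).le, fun s => (hf s).le⟩, ?_, rfl⟩)
    refine Prod.ext ?_ (Prod.ext ?_ ?_)
    · funext s x
      exact (hq s x).symm
    · funext s x
      simp [Aop]
    · funext t
      simp [Aop]

/-! ### Representation of linear functionals and boundedness -/

theorem LinearMap.pi_apply_eq_sum_mul_single {ι : Type*} [Fintype ι] [DecidableEq ι]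
    (g : (ι → ℝ) →ₗ[ℝ] ℝ)
    (k : ι → ℝ) : g k = ∑ i, g (Pi.single i 1) * k i := by
  conv_lhs => rw [← Finset.univ_sum_single k, map_sum]
  refine Finset.sum_congr rfl fun i _ => ?_
  rw [mul_comm, ← smul_eq_mul, ← map_smul, ← Pi.single_smul, smul_eq_mul, mul_one]

theorem exists_kpair_eq (g : Ksp T n →ₗ[ℝ] ℝ) : ∃ k : Ksp T n, ∀ k', g k' = kpair k k' := by
  have hM : ∀ h : Msp T n →ₗ[ℝ] ℝ, ∃ a : Msp T n, ∀ b, h b = ∑ s, ∑ x, a s x * b s x := by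
    intro h
    refine ⟨fun s x => h (Pi.single s (Pi.single x 1)), fun b => ?_⟩
    conv_lhs => rw [← Finset.univ_sum_single b, map_sum]
    exact Finset.sum_congr rfl fun s _ => LinearMap.pi_apply_eq_sum_mul_single
      (h ∘ₗ LinearMap.single ℝ (fun _ => Fin n → ℝ) s) (b s)
  obtain ⟨a, ha⟩ := hM (g ∘ₗ LinearMap.inl ℝ _ _)
  obtain ⟨b, hb⟩ := hM (g ∘ₗ LinearMap.inr ℝ _ _ ∘ₗ LinearMap.inl ℝ _ _)
  have hd := LinearMap.pi_apply_eq_sum_mul_single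
    (g ∘ₗ LinearMap.inr ℝ (Msp T n) _ ∘ₗ LinearMap.inr ℝ (Msp T n) (Psp T))
  refine ⟨(a, b, fun t => g (0, 0, Pi.single t 1)), fun k => ?_⟩
  simp only [kpair]
  rw [← ha, ← hb]
  refine Eq.trans ?_ (congrArg _ (hd k.2.2))
  simp only [LinearMap.comp_apply, LinearMap.inl_apply, LinearMap.inr_apply]
  rw [← map_add, ← map_add]
  simp

/-- A set of dual variables whose pairing with each direction is bounded below is bounded. -/
theorem isBounded_of_forall_le_kpair {A : Set (Ksp T n)}
    (h : ∀ e : Ksp T n, ∃ C : ℝ, ∀ k ∈ A, C ≤ kpair k e) : IsBounded A := by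
  have hcoord : ∀ (π : Ksp T n → ℝ) (e : Ksp T n), (∀ k, kpair k e = π k) →
      (∀ k, kpair k (-e) = -π k) → IsBounded (π '' A) := by
    intro π e he he'
    obtain ⟨C, hC⟩ := h e
    obtain ⟨C', hC'⟩ := h (-e)
    refine (Metric.isBounded_Icc C (-C')).subset ?_
    rintro _ ⟨k, hk, rfl⟩
    have h₁ := hC k hk
    have h₂ := hC' k hk
    rw [he] at h₁
    rw [he'] at h₂
    exact ⟨h₁, by linarith⟩
  have hneg : ∀ k e : Ksp T n, kpair k (-e) = -kpair k e := fun k e => by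
    simp only [kpair, Prod.fst_neg, Prod.snd_neg, Pi.neg_apply, mul_neg, Finset.sum_neg_distrib]
    ring
  rw [← isBounded_image_fst_and_snd, ← isBounded_image_fst_and_snd]
  refine ⟨?_, ?_, ?_⟩
  · refine forall_isBounded_image_eval_iff.1 fun s => forall_isBounded_image_eval_iff.1 fun x => ?_
    simp only [Set.image_image]
    have he : ∀ k : Ksp T n, kpair k (Pi.single s (Pi.single x 1), 0, 0) = k.1 s x := fun k => by
      simp [kpair, Pi.single_apply, ite_apply]
    exact hcoord _ _ he fun k => by rw [hneg, he]
  · refine forall_isBounded_image_eval_iff.1 fun s => forall_isBounded_image_eval_iff.1 fun x => ?_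
    simp only [Set.image_image]
    have he : ∀ k : Ksp T n, kpair k (0, Pi.single s (Pi.single x 1), 0) = k.2.1 s x := fun k => by
      simp [kpair, Pi.single_apply, ite_apply]
    exact hcoord _ _ he fun k => by rw [hneg, he]
  · refine forall_isBounded_image_eval_iff.1 fun t => ?_
    simp only [Set.image_image]
    have he : ∀ k : Ksp T n, kpair k (0, 0, Pi.single t 1) = k.2.2 t := fun k => by
      simp [kpair, Pi.single_apply]
    exact hcoord _ _ he fun k => by rw [hneg, he]

/-- Theorem 1: under the convexity and qualification assumptions,
the dual problem (D) has a nonempty bounded set of solutions and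
`val(D) = val(P̃)`. -/
theorem duality_theorem {T n : ℕ} (hT : 1 ≤ T) (hn : 1 ≤ n)
    (ℓ : LSp T n) (F : FSp T n) (φ : PhiSp T) (α : ASp T n)
    (m0 : Fin n → ℝ) (hm0 : m0 ∈ simplex n)
    (hconv : ConvAssumption ℓ F φ) (hqual : Qualif ℓ F φ α m0) :
    {k : Ksp T n | IsSolD ℓ F φ α m0 k}.Nonempty ∧
    IsBounded {k : Ksp T n | IsSolD ℓ F φ α m0 k} ∧
    valD ℓ F φ α m0 = valPt ℓ F φ α m0 := by
  have habs := exists_pos_smul_mem_perturbEpi hconv hqual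
  obtain ⟨L, hL⟩ := exists_lower_bound_perturbEpi α hm0 hconv
  have hbdd : BddBelow {r : ℝ | ((0 : Ksp T n), r) ∈ perturbEpi ℓ F φ α m0} := ⟨L, hL⟩
  have hne : {r : ℝ | ((0 : Ksp T n), r) ∈ perturbEpi ℓ F φ α m0}.Nonempty := by
    obtain ⟨δ, -, r, hr⟩ := habs 0
    exact ⟨r, by simpa using hr⟩
  have hval := valPt_eq_sInf hconv hne hbdd
  set v : ℝ := sInf {r : ℝ | ((0 : Ksp T n), r) ∈ perturbEpi ℓ F φ α m0}
  obtain ⟨g, hg⟩ := exists_linearMap_supporting (convex_perturbEpi α m0 hconv)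
    (v := v) (fun r hr => csInf_le hbdd hr) habs
  obtain ⟨k, hk⟩ := exists_kpair_eq g
  simp only [hk] at hg
  have hfeas := feasD_of_supporting hconv hg
  have hobj := le_Dobj_of_supporting hconv hg
  have hweak : ∀ k', FeasD ℓ α k' → Dobj F φ m0 k' ≤ v := by
    intro k' hk'
    by_contra! hlt
    obtain ⟨z, hz₁, hz₂⟩ := EReal.lt_iff_exists_real_btwn.1 hlt
    obtain ⟨r, hr, hrz⟩ := exists_lt_of_csInf_lt hne (EReal.coe_lt_coe_iff.1 hz₁)
    have h := Dobj_le_of_mem_perturbEpi hconv hk' hr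
    have h0 : kpair k' 0 = 0 := by simp [kpair]
    simp only [h0, add_zero] at h
    exact absurd (hz₂.trans_le h) (not_lt.2 (EReal.coe_le_coe_iff.2 hrz.le))
  have hsol : IsSolD ℓ F φ α m0 k := ⟨hfeas, fun k' hk' => (hweak k' hk').trans hobj⟩
  refine ⟨⟨k, hsol⟩, isBounded_of_forall_le_kpair fun e => ?_, ?_⟩
  · obtain ⟨δ, hδ, r, hr⟩ := habs e
    refine ⟨(v - r) / δ, fun k' hk' => ?_⟩
    have h := (hobj.trans (hk'.2 k hfeas)).trans (Dobj_le_of_mem_perturbEpi hconv hk'.1 hr)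
    have h' : kpair k' (δ • e) = δ * kpair k' e := by
      simp only [kpair, Prod.smul_fst, Prod.smul_snd, Pi.smul_apply, smul_eq_mul, mul_add,
        Finset.mul_sum, mul_left_comm]
    rw [EReal.coe_le_coe_iff, h'] at h
    rw [div_le_iff₀ hδ]
    linarith
  · rw [hval]
    exact le_antisymm (iSup₂_le hweak)
      (hobj.trans (le_iSup₂ (f := fun (k : Ksp T n) _ => Dobj F φ m0 k) k hfeas))

end
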